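/- A closed circle in a decorated circle diagram either admits no orientation at all, or admits exactly two orientations; in the latter case, the degrees (number of clockwise cups plus clockwise caps) of the two orientations differ by exactly 2 and equal the number of caps in the circle plus 1 and minus 1 respectively. -/

import Mathlib

open scoped Classical

/-! STATEMENT 4: A closed circle in a decorated circle diagram either admits no
orientation at all or exactly two; in the latter case the degrees of the two
orientations differ by exactly `2` and equal the number of caps of the circle
plus `1` and minus `1` respectively.

Model: a closed circle has `n = 2*s` arcs and vertices; arc `t` joins vertex
`t` and vertex `(t+1) % n`; as one travels around a circle cups and caps
alternate, so arcs with even index are cups (below the number line) and arcs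
with odd index are caps (above it); in particular the circle has exactly `s`
caps.  The vertices sit at pairwise distinct positions `pos t` on the number
line.  Since the diagram is planar, two arcs on the same side never cross, and
(by the rules for decorations) a dotted arc is never nested inside another arc
on the same side.  An orientation labels the vertices by `∧/∨`
(`true`/`false`): along a dotted arc the label is preserved (dots reverse
orientation), along an undotted arc it flips.  An undotted arc is clockwise
(degree `1`) iff its left endpoint carries `∧`; a dotted arc is clockwise iff
its left endpoint carries `∨`; the degree of an orientation is the number of
clockwise arcs. -/

namespace CircleDiagram

/-- position of the left endpoint of arc `t`. -/
noncomputable def lo (n : ℕ) (pos : ℕ → ℕ) (t : ℕ) : ℕ :=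
  min (pos t) (pos ((t + 1) % n))

/-- position of the right endpoint of arc `t`. -/
noncomputable def hi (n : ℕ) (pos : ℕ → ℕ) (t : ℕ) : ℕ :=
  max (pos t) (pos ((t + 1) % n))

/-- `o` is an orientation of the circle. -/
def IsOrient (n : ℕ) (dotted : ℕ → Bool) (o : ℕ → Bool) : Prop :=
  ∀ t < n, o ((t + 1) % n) = if dotted t = true then o t else !(o t)

/-- the label at the left endpoint of arc `t`. -/
noncomputable def leftLabel (n : ℕ) (pos : ℕ → ℕ) (o : ℕ → Bool) (t : ℕ) : Bool :=
  if pos t < pos ((t + 1) % n) then o t else o ((t + 1) % n)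

/-- arc `t` is clockwise (of degree `1`). -/
noncomputable def clockwise (n : ℕ) (pos : ℕ → ℕ) (dotted o : ℕ → Bool)
    (t : ℕ) : Bool :=
  if dotted t = true then !(leftLabel n pos o t) else leftLabel n pos o t

/-- the degree of the oriented circle. -/
noncomputable def deg (n : ℕ) (pos : ℕ → ℕ) (dotted o : ℕ → Bool) : ℕ :=
  ((Finset.range n).filter fun t => clockwise n pos dotted o t = true).card

end CircleDiagram

namespace CircleDiagram

structure Good (s : ℕ) (pos : ℕ → ℕ) (dotted o : ℕ → Bool) : Prop where
  inj : ∀ t < 2 * s, ∀ t' < 2 * s, pos t = pos t' → t = t'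
  nc : ∀ t < 2 * s, ∀ t' < 2 * s, t % 2 = t' % 2 →
      ¬ (lo (2 * s) pos t < lo (2 * s) pos t' ∧
          lo (2 * s) pos t' < hi (2 * s) pos t ∧
          hi (2 * s) pos t < hi (2 * s) pos t')
  dot : ∀ t < 2 * s, dotted t = true → ∀ t' < 2 * s, t % 2 = t' % 2 →
      ¬ (lo (2 * s) pos t' < lo (2 * s) pos t ∧
          hi (2 * s) pos t < hi (2 * s) pos t')
  orient : IsOrient (2 * s) dotted o

lemma nx_cases {n t : ℕ} (h : t < n) :
    (t + 1 < n ∧ (t + 1) % n = t + 1) ∨ (t + 1 = n ∧ (t + 1) % n = 0) := by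
  rcases Nat.lt_or_ge (t + 1) n with h1 | h1
  · exact Or.inl ⟨h1, Nat.mod_eq_of_lt h1⟩
  · have : t + 1 = n := by omega
    exact Or.inr ⟨this, by rw [this, Nat.mod_self]⟩

lemma exists_arc {s v : ℕ} (p : ℕ) (hv : v < 2 * s) :
    ∃ u < 2 * s, u % 2 = p % 2 ∧ (u = v ∨ (u + 1) % (2 * s) = v) := by
  by_cases h : v % 2 = p % 2
  · exact ⟨v, hv, h, Or.inl rfl⟩
  · rcases Nat.eq_zero_or_pos v with h0 | h0
    · refine ⟨2 * s - 1, by omega, by omega, Or.inr ?_⟩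
      rw [show 2 * s - 1 + 1 = 2 * s by omega, Nat.mod_self, h0]
    · refine ⟨v - 1, by omega, by omega, Or.inr ?_⟩
      rw [show v - 1 + 1 = v by omega, Nat.mod_eq_of_lt hv]

lemma nested {s : ℕ} {pos : ℕ → ℕ} {dotted o : ℕ → Bool} (G : Good s pos dotted o)
    {t v : ℕ} (ht : t < 2 * s) (hv : v < 2 * s)
    (h1 : lo (2 * s) pos t < pos v) (h2 : pos v < hi (2 * s) pos t) :
    ∃ u < 2 * s, u % 2 = t % 2 ∧ lo (2 * s) pos t < lo (2 * s) pos u ∧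
      hi (2 * s) pos u < hi (2 * s) pos t := by
  obtain ⟨u, hu, hp, hh⟩ := exists_arc t hv
  refine ⟨u, hu, hp, ?_⟩
  have c1 := G.nc t ht u hu hp.symm
  have c2 := G.nc u hu t ht hp
  have hut : u ≠ t := by
    rintro rfl
    simp only [lo, hi] at h1 h2
    rcases hh with rfl | rfl <;> omega
  have n1 := nx_cases ht
  have n2 := nx_cases hu
  have l1 : (t + 1) % (2 * s) < 2 * s := by omega
  have l2 : (u + 1) % (2 * s) < 2 * s := by omega
  have d1 : pos u ≠ pos t := fun h => hut (G.inj _ hu _ ht h)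
  have d2 : pos u ≠ pos ((t + 1) % (2 * s)) := fun h => by
    have := G.inj _ hu _ l1 h
    omega
  have d3 : pos ((u + 1) % (2 * s)) ≠ pos t := fun h => by
    have := G.inj _ l2 _ ht h
    omega
  have d4 : pos ((u + 1) % (2 * s)) ≠ pos ((t + 1) % (2 * s)) := fun h => by
    have := G.inj _ l2 _ l1 h
    omega
  have hpv : pos v = pos u ∨ pos v = pos ((u + 1) % (2 * s)) := by
    rcases hh with rfl | rfl
    · exact Or.inl rfl
    · exact Or.inr rfl
  simp only [lo, hi] at *
  generalize pos ((u + 1) % (2 * s)) = U at *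
  generalize pos ((t + 1) % (2 * s)) = T at *
  generalize pos u = u' at *
  generalize pos t = t' at *
  generalize pos v = v' at *
  clear n1 n2 l1 l2 hh hp hut G
  omega

lemma exists_undotted {s : ℕ} (hs : 2 ≤ s) {pos : ℕ → ℕ} {dotted o : ℕ → Bool}
    (G : Good s pos dotted o) : ∃ t < 2 * s, dotted t = false := by
  by_contra hcon
  have hd : ∀ t < 2 * s, dotted t = true := fun t ht => by
    by_contra h
    exact hcon ⟨t, ht, by simpa using h⟩
  have no : ∀ t < 2 * s, ∀ v < 2 * s,
      ¬ (lo (2 * s) pos t < pos v ∧ pos v < hi (2 * s) pos t) := by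
    rintro t ht v hv ⟨h1, h2⟩
    obtain ⟨u, hu, hp, h⟩ := nested G ht hv h1 h2
    exact G.dot u hu (hd u hu) t ht hp h
  obtain ⟨m, hm, hmin⟩ := Finset.exists_min_image (Finset.range (2 * s)) pos
    ⟨0, by simp; omega⟩
  simp only [Finset.mem_range] at hm hmin
  obtain ⟨w, hw, hwp, hwm⟩ := exists_arc (m + 1) hm
  have hwm : (w + 1) % (2 * s) = m := by
    rcases hwm with rfl | h
    · omega
    · exact h
  have n1 := nx_cases hm
  have n2 := nx_cases hw
  have l1 : (m + 1) % (2 * s) < 2 * s := by omega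
  have e1 := no w hw _ l1
  have e2 := no m hm _ hw
  have d1 : pos w ≠ pos m := fun h => by
    have := G.inj _ hw _ hm h
    omega
  have d2 : pos ((m + 1) % (2 * s)) ≠ pos m := fun h => by
    have := G.inj _ l1 _ hm h
    omega
  have d3 : pos ((m + 1) % (2 * s)) ≠ pos w := fun h => by
    have := G.inj _ l1 _ hw h
    omega
  have m1 := hmin _ hw
  have m2 := hmin _ l1
  simp only [lo, hi] at e1 e2
  rw [hwm] at e1
  omega

lemma exists_small {s : ℕ} (hs : 2 ≤ s) {pos : ℕ → ℕ} {dotted o : ℕ → Bool}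
    (G : Good s pos dotted o) : ∃ t < 2 * s, dotted t = false ∧
      ∀ v < 2 * s, ¬ (lo (2 * s) pos t < pos v ∧ pos v < hi (2 * s) pos t) := by
  obtain ⟨t0, ht0, hd0⟩ := exists_undotted hs G
  obtain ⟨t, ht, hmin⟩ := Finset.exists_min_image
    ((Finset.range (2 * s)).filter fun t => dotted t = false)
    (fun t => hi (2 * s) pos t - lo (2 * s) pos t) ⟨t0, by simp [ht0, hd0]⟩
  simp only [Finset.mem_filter, Finset.mem_range] at ht hmin
  refine ⟨t, ht.1, ht.2, ?_⟩
  rintro v hv ⟨h1, h2⟩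
  obtain ⟨u, hu, hp, h3, h4⟩ := nested G ht.1 hv h1 h2
  have hud : dotted u = false := by
    by_contra h
    exact G.dot u hu (by simpa using h) t ht.1 hp ⟨h3, h4⟩
  have := hmin u ⟨hu, hud⟩
  have : lo (2 * s) pos u ≤ hi (2 * s) pos u := by simp [lo, hi]
  omega

/-- rotation of a cyclic sequence -/
def rot {α : Type} (n r : ℕ) (f : ℕ → α) (t : ℕ) : α := f ((t + r) % n)

lemma rot_nx (n r t : ℕ) : ((t + 1) % n + r) % n = ((t + r) % n + 1) % n := by
  rw [Nat.mod_add_mod, Nat.mod_add_mod]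
  congr 1
  omega

lemma lo_rot (n r : ℕ) (pos : ℕ → ℕ) (t : ℕ) :
    lo n (rot n r pos) t = lo n pos ((t + r) % n) := by
  simp only [lo, rot, rot_nx]

lemma hi_rot (n r : ℕ) (pos : ℕ → ℕ) (t : ℕ) :
    hi n (rot n r pos) t = hi n pos ((t + r) % n) := by
  simp only [hi, rot, rot_nx]

lemma clockwise_rot (n r : ℕ) (pos : ℕ → ℕ) (dotted o : ℕ → Bool) (t : ℕ) :
    clockwise n (rot n r pos) (rot n r dotted) (rot n r o) t
      = clockwise n pos dotted o ((t + r) % n) := by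
  simp only [clockwise, leftLabel, rot, rot_nx]

lemma rot_cancel {n r q t : ℕ} (hq : (r + q) % n = 0) (ht : t < n) :
    ((t + r) % n + q) % n = t := by
  rw [Nat.mod_add_mod, Nat.add_assoc, Nat.add_mod, hq, Nat.add_zero, Nat.mod_mod,
    Nat.mod_eq_of_lt ht]

lemma deg_rot {n r : ℕ} (hr : r < n) (pos : ℕ → ℕ) (dotted o : ℕ → Bool) :
    deg n (rot n r pos) (rot n r dotted) (rot n r o) = deg n pos dotted o := by
  have hn : 0 < n := by omega
  have q1 : (r + (n - r)) % n = 0 := by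
    rw [show r + (n - r) = n by omega, Nat.mod_self]
  have q2 : ((n - r) + r) % n = 0 := by
    rw [show (n - r) + r = n by omega, Nat.mod_self]
  unfold deg
  refine Finset.card_nbij' (fun t => (t + r) % n) (fun t => (t + (n - r)) % n) ?_ ?_ ?_ ?_
  · intro t ht
    simp only [Finset.coe_filter, Finset.mem_range, Set.mem_ofPred_eq] at ht ⊢
    rw [clockwise_rot] at ht
    exact ⟨Nat.mod_lt _ hn, ht.2⟩
  · intro t ht
    simp only [Finset.coe_filter, Finset.mem_range, Set.mem_ofPred_eq] at ht ⊢
    rw [clockwise_rot, rot_cancel q2 ht.1]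
    exact ⟨Nat.mod_lt _ hn, ht.2⟩
  · intro t ht
    simp only [Finset.coe_filter, Finset.mem_range, Set.mem_ofPred_eq] at ht
    exact rot_cancel q1 ht.1
  · intro t ht
    simp only [Finset.coe_filter, Finset.mem_range, Set.mem_ofPred_eq] at ht
    exact rot_cancel q2 ht.1

lemma good_rot {s r : ℕ} (hr : r < 2 * s) {pos : ℕ → ℕ} {dotted o : ℕ → Bool}
    (G : Good s pos dotted o) :
    Good s (rot (2 * s) r pos) (rot (2 * s) r dotted) (rot (2 * s) r o) := by
  have hn : 0 < 2 * s := by omega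
  have L : ∀ t, (t + r) % (2 * s) < 2 * s := fun t => Nat.mod_lt _ hn
  have par : ∀ t t', t % 2 = t' % 2 →
      ((t + r) % (2 * s)) % 2 = ((t' + r) % (2 * s)) % 2 := fun t t' h => by
    rw [Nat.mod_mod_of_dvd _ (Dvd.intro _ rfl), Nat.mod_mod_of_dvd _ (Dvd.intro _ rfl)]
    omega
  have q1 : (r + (2 * s - r)) % (2 * s) = 0 := by
    rw [show r + (2 * s - r) = 2 * s by omega, Nat.mod_self]
  refine ⟨?_, ?_, ?_, ?_⟩
  · intro t ht t' ht' h
    have := G.inj _ (L t) _ (L t') h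
    rw [← rot_cancel q1 ht, ← rot_cancel q1 ht', this]
  · intro t _ t' _ h
    simp only [lo_rot, hi_rot]
    exact G.nc _ (L t) _ (L t') (par _ _ h)
  · intro t _ hd t' _ h
    simp only [lo_rot, hi_rot]
    exact G.dot _ (L t) hd _ (L t') (par _ _ h)
  · intro t _
    simp only [rot, rot_nx]
    exact G.orient _ (L t)

/-- new decoration after removing a small arc -/
def red (k : ℕ) (dotted : ℕ → Bool) (t : ℕ) : Bool :=
  if t = 2 * k + 1 then xor (dotted (2 * k + 1)) (dotted (2 * k + 3)) else dotted t

lemma deg_eq_sum (n : ℕ) (pos : ℕ → ℕ) (dotted o : ℕ → Bool) :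
    deg n pos dotted o
      = ∑ t ∈ Finset.range n, (if clockwise n pos dotted o t = true then 1 else 0) := by
  rw [deg, Finset.card_filter]

section step
variable {k : ℕ} {pos : ℕ → ℕ} {dotted o : ℕ → Bool}


lemma red_lo {t : ℕ} (ht : t < 2 * k + 1) :
    lo (2 * (k + 1)) pos t = lo (2 * (k + 2)) pos t := by
  simp only [lo]
  rw [Nat.mod_eq_of_lt (show t + 1 < 2 * (k + 1) by omega),
    Nat.mod_eq_of_lt (show t + 1 < 2 * (k + 2) by omega)]

lemma red_hi {t : ℕ} (ht : t < 2 * k + 1) :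
    hi (2 * (k + 1)) pos t = hi (2 * (k + 2)) pos t := by
  simp only [hi]
  rw [Nat.mod_eq_of_lt (show t + 1 < 2 * (k + 1) by omega),
    Nat.mod_eq_of_lt (show t + 1 < 2 * (k + 2) by omega)]

lemma red_clockwise {t : ℕ} (ht : t < 2 * k + 1) :
    clockwise (2 * (k + 1)) pos (red k dotted) o t
      = clockwise (2 * (k + 2)) pos dotted o t := by
  simp only [clockwise, leftLabel]
  rw [Nat.mod_eq_of_lt (show t + 1 < 2 * (k + 1) by omega),
    Nat.mod_eq_of_lt (show t + 1 < 2 * (k + 2) by omega)]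
  have : red k dotted t = dotted t := by
    simp only [red]
    rw [if_neg (by omega)]
  rw [this]

lemma mod_a (k : ℕ) : (2 * k + 1 + 1) % (2 * (k + 1)) = 0 := by
  rw [show 2 * k + 1 + 1 = 2 * (k + 1) by omega, Nat.mod_self]
lemma mod_b (k : ℕ) : (2 * k + 1 + 1) % (2 * (k + 2)) = 2 * k + 2 :=
  Nat.mod_eq_of_lt (by omega)
lemma mod_c (k : ℕ) : (2 * k + 2 + 1) % (2 * (k + 2)) = 2 * k + 3 :=
  Nat.mod_eq_of_lt (by omega)
lemma mod_d (k : ℕ) : (2 * k + 3 + 1) % (2 * (k + 2)) = 0 := by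
  rw [show 2 * k + 3 + 1 = 2 * (k + 2) by omega, Nat.mod_self]

lemma avoid {c d c' d' P : ℕ} (k1 : c = c' ∨ c = d') (k2 : d = c' ∨ d = d') (h : c' ≠ P)
    (h' : d' ≠ P) : c ≠ P ∧ d ≠ P := by
  omega

lemma adj {A B : ℕ} (c : ℕ) (h : ¬ (min A B < c ∧ c < max A B)) (h1 : c ≠ A) (h2 : c ≠ B) :
    c < A ↔ c < B := by
  omega

lemma sep {c d a A : ℕ} (h : c < d) (ha : c ≠ a ∧ d ≠ a) (hA : c ≠ A ∧ d ≠ A)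
    (x1 : ¬ (c < min a A ∧ min a A < d ∧ d < max a A))
    (x2 : ¬ (min a A < c ∧ c < max a A ∧ max a A < d)) :
    (c < a ∧ a < d) ↔ (c < A ∧ A < d) := by
  omega

set_option maxHeartbeats 1000000 in
lemma geom (G : Good (k + 2) pos dotted o)
    (hsm : ∀ v < 2 * (k + 2), ¬ (lo (2 * (k + 2)) pos (2 * k + 2) < pos v ∧
      pos v < hi (2 * (k + 2)) pos (2 * k + 2))) {t : ℕ} (ht : t < 2 * k + 1)
    (hp : t % 2 = (2 * k + 1) % 2) :
    ¬ (lo (2 * (k + 1)) pos t < lo (2 * (k + 1)) pos (2 * k + 1) ∧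
          lo (2 * (k + 1)) pos (2 * k + 1) < hi (2 * (k + 1)) pos t ∧
          hi (2 * (k + 1)) pos t < hi (2 * (k + 1)) pos (2 * k + 1)) ∧
    ¬ (lo (2 * (k + 1)) pos (2 * k + 1) < lo (2 * (k + 1)) pos t ∧
          lo (2 * (k + 1)) pos t < hi (2 * (k + 1)) pos (2 * k + 1) ∧
          hi (2 * (k + 1)) pos (2 * k + 1) < hi (2 * (k + 1)) pos t) ∧
    (dotted t = true → ¬ (lo (2 * (k + 1)) pos (2 * k + 1) < lo (2 * (k + 1)) pos t ∧
          hi (2 * (k + 1)) pos t < hi (2 * (k + 1)) pos (2 * k + 1))) ∧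
    (red k dotted (2 * k + 1) = true →
      ¬ (lo (2 * (k + 1)) pos t < lo (2 * (k + 1)) pos (2 * k + 1) ∧
          hi (2 * (k + 1)) pos (2 * k + 1) < hi (2 * (k + 1)) pos t)) := by
  have t1 : t < 2 * (k + 2) := by omega
  have a1 : 2 * k + 1 < 2 * (k + 2) := by omega
  have b1 : 2 * k + 3 < 2 * (k + 2) := by omega
  have hp' : t % 2 = (2 * k + 3) % 2 := by omega
  have hab : (2 * k + 1) % 2 = (2 * k + 3) % 2 := by omega
  have x1 := G.nc t t1 _ a1 hp
  have x2 := G.nc _ a1 t t1 hp.symm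
  have x3 := G.nc t t1 _ b1 hp'
  have x4 := G.nc _ b1 t t1 hp'.symm
  have y1 := fun h => G.dot t t1 h _ a1 hp
  have y2 := fun h => G.dot t t1 h _ b1 hp'
  have y3 := fun h => G.dot _ a1 h t t1 hp.symm
  have y4 := fun h => G.dot _ b1 h t t1 hp'.symm
  have z1 := hsm t t1
  have z2 := hsm (t + 1) (by omega)
  have z3 := hsm (2 * k + 1) (by omega)
  have z4 := hsm 0 (by omega)
  have D : ∀ i < 2 * (k + 2), ∀ j < 2 * (k + 2), i ≠ j → pos i ≠ pos j :=
    fun i hi j hj hij h => hij (G.inj i hi j hj h)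
  have e0 := D t t1 (t + 1) (by omega) (by omega)
  have e1 := D t t1 (2 * k + 1) (by omega) (by omega)
  have e2 := D t t1 (2 * k + 2) (by omega) (by omega)
  have e3 := D t t1 (2 * k + 3) (by omega) (by omega)
  have e4 := D t t1 0 (by omega) (by omega)
  have f1 := D (t + 1) (by omega) (2 * k + 1) (by omega) (by omega)
  have f2 := D (t + 1) (by omega) (2 * k + 2) (by omega) (by omega)
  have f3 := D (t + 1) (by omega) (2 * k + 3) (by omega) (by omega)
  have f4 := D (t + 1) (by omega) 0 (by omega) (by omega)
  have g1 := D (2 * k + 1) (by omega) (2 * k + 2) (by omega) (by omega)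
  have g2 := D (2 * k + 1) (by omega) (2 * k + 3) (by omega) (by omega)
  have g3 := D (2 * k + 1) (by omega) 0 (by omega) (by omega)
  have g4 := D (2 * k + 2) (by omega) (2 * k + 3) (by omega) (by omega)
  have g5 := D (2 * k + 2) (by omega) 0 (by omega) (by omega)
  have g6 := D (2 * k + 3) (by omega) 0 (by omega) (by omega)
  have r : red k dotted (2 * k + 1) = true →
      dotted (2 * k + 1) = true ∨ dotted (2 * k + 3) = true := by
    simp only [red, if_true]
    cases dotted (2 * k + 1) <;> cases dotted (2 * k + 3) <;> simp
  have u1 : (t + 1) % (2 * (k + 1)) = t + 1 := Nat.mod_eq_of_lt (by omega)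
  have u2 : (t + 1) % (2 * (k + 2)) = t + 1 := Nat.mod_eq_of_lt (by omega)
  simp only [lo, hi, mod_a, mod_b, mod_c, mod_d, u1, u2] at *
  have k1 := min_choice (pos t) (pos (t + 1))
  have k2 := max_choice (pos t) (pos (t + 1))
  have k3 := min_lt_max.2 e0
  generalize pos (2 * k + 1) = a at *
  generalize pos (2 * k + 2) = A at *
  generalize pos (2 * k + 3) = B at *
  generalize pos 0 = b at *
  generalize pos t = c' at *
  generalize pos (t + 1) = d' at *
  generalize min c' d' = c at *
  generalize max c' d' = d at *
  clear D hsm G a1 b1 hp' hab u1 u2 z3 z4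
  have w : ∀ P : ℕ, c' ≠ P → d' ≠ P → c ≠ P ∧ d ≠ P := fun P h h' => avoid k1 k2 h h'
  have wa := w a e1 f1
  have wA := w A e2 f2
  have wB := w B e3 f3
  have wb := w b e4 f4
  have z5 := adj c' z1 e2 e3
  have z6 := adj d' z2 f2 f3
  have v1 : (c < A ↔ c < B) ∧ (d < A ↔ d < B) := by
    constructor
    · rcases k1 with h | h <;> rw [h] <;> assumption
    · rcases k2 with h | h <;> rw [h] <;> assumption
  clear z5 z6 w z1 z2 e0 e1 e2 e3 e4 f1 f2 f3 f4 k1 k2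
  have i1 := sep k3 wa wA x1 x2
  have i2 := sep k3 wB wb x3 x4
  clear x1 x2 x3 x4
  have i3 : (c < a ∧ a < d) ↔ (c < b ∧ b < d) := by
    clear y1 y2 y3 y4 r g1 g2 g3 g4 g5 g6
    omega
  refine ⟨?_, ?_, ?_, ?_⟩
  · clear y1 y2 y3 y4 r
    omega
  · clear y1 y2 y3 y4 r
    omega
  · intro h
    have y1 := y1 h
    have y2 := y2 h
    clear y3 y4 r
    omega
  · intro h
    rcases r h with h | h
    · have y3 := y3 h
      clear y1 y2 y4 r
      omega
    · have y4 := y4 h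
      clear y1 y2 y3 r
      omega

lemma good_red (G : Good (k + 2) pos dotted o) (hd : dotted (2 * k + 2) = false)
    (hsm : ∀ v < 2 * (k + 2), ¬ (lo (2 * (k + 2)) pos (2 * k + 2) < pos v ∧
      pos v < hi (2 * (k + 2)) pos (2 * k + 2))) :
    Good (k + 1) pos (red k dotted) o := by
  have hc : ∀ t < 2 * (k + 1), t = 2 * k + 1 ∨ t < 2 * k + 1 := fun t ht => by omega
  have hr : ∀ t < 2 * k + 1, red k dotted t = dotted t := fun t ht => by
    simp only [red]
    rw [if_neg (by omega)]
  refine ⟨fun t ht t' ht' => G.inj t (by omega) t' (by omega), ?_, ?_, ?_⟩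
  · intro t ht t' ht' hp
    rcases hc t ht with rfl | h1 <;> rcases hc t' ht' with rfl | h2
    · omega
    · exact (geom G hsm h2 hp.symm).2.1
    · exact (geom G hsm h1 hp).1
    · rw [red_lo h1, red_lo h2, red_hi h1, red_hi h2]
      exact G.nc t (by omega) t' (by omega) hp
  · intro t ht hdt t' ht' hp
    rcases hc t ht with rfl | h1 <;> rcases hc t' ht' with rfl | h2
    · omega
    · exact (geom G hsm h2 hp.symm).2.2.2 hdt
    · rw [hr t h1] at hdt
      exact (geom G hsm h1 hp).2.2.1 hdt
    · rw [red_lo h1, red_lo h2, red_hi h1, red_hi h2]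
      rw [hr t h1] at hdt
      exact G.dot t (by omega) hdt t' (by omega) hp
  · intro t ht
    rcases hc t ht with rfl | h1
    · have o1 := G.orient (2 * k + 1) (by omega)
      have o2 := G.orient (2 * k + 2) (by omega)
      have o3 := G.orient (2 * k + 3) (by omega)
      rw [mod_b] at o1
      rw [mod_c] at o2
      rw [mod_d] at o3
      rw [mod_a, o3, o2, o1, hd]
      simp only [red, if_true]
      cases dotted (2 * k + 1) <;> cases dotted (2 * k + 3) <;> simp
    · have o1 := G.orient t (by omega)
      rw [Nat.mod_eq_of_lt (show t + 1 < 2 * (k + 2) by omega)] at o1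
      rw [Nat.mod_eq_of_lt (show t + 1 < 2 * (k + 1) by omega), hr t h1]
      exact o1

lemma deg_red (G : Good (k + 2) pos dotted o) (hd : dotted (2 * k + 2) = false)
    (hsm : ∀ v < 2 * (k + 2), ¬ (lo (2 * (k + 2)) pos (2 * k + 2) < pos v ∧
      pos v < hi (2 * (k + 2)) pos (2 * k + 2))) :
    deg (2 * (k + 2)) pos dotted o = deg (2 * (k + 1)) pos (red k dotted) o + 1 := by
  have e1 : ∀ f : ℕ → ℕ, ∑ t ∈ Finset.range (2 * (k + 2)), f t =
      ∑ t ∈ Finset.range (2 * k + 1), f t + (f (2 * k + 1) + (f (2 * k + 2) + f (2 * k + 3))) := by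
    intro f
    rw [show 2 * (k + 2) = 2 * k + 1 + 1 + 1 + 1 by omega, Finset.sum_range_succ,
      Finset.sum_range_succ, Finset.sum_range_succ, add_assoc, add_assoc]
  have e2 : ∀ f : ℕ → ℕ, ∑ t ∈ Finset.range (2 * (k + 1)), f t =
      ∑ t ∈ Finset.range (2 * k + 1), f t + f (2 * k + 1) := by
    intro f
    rw [show 2 * (k + 1) = 2 * k + 1 + 1 by omega, Finset.sum_range_succ]
  rw [deg_eq_sum, deg_eq_sum, e1, e2]
  rw [Finset.sum_congr rfl (g := fun t =>
    if clockwise (2 * (k + 1)) pos (red k dotted) o t = true then 1 else 0)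
    (fun t ht => by rw [red_clockwise (Finset.mem_range.1 ht)])]
  have o1 := G.orient (2 * k + 1) (by omega)
  have o2 := G.orient (2 * k + 2) (by omega)
  have o3 := G.orient (2 * k + 3) (by omega)
  have a1 : 2 * k + 1 < 2 * (k + 2) := by omega
  have b1 : 2 * k + 3 < 2 * (k + 2) := by omega
  have hab : (2 * k + 1) % 2 = (2 * k + 3) % 2 := by omega
  have x5 := G.nc _ a1 _ b1 hab
  have x6 := G.nc _ b1 _ a1 hab.symm
  have y5 := fun h => G.dot _ a1 h _ b1 hab
  have y6 := fun h => G.dot _ b1 h _ a1 hab.symm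
  have z3 := hsm (2 * k + 1) (by omega)
  have z4 := hsm 0 (by omega)
  have D : ∀ i < 2 * (k + 2), ∀ j < 2 * (k + 2), i ≠ j → pos i ≠ pos j :=
    fun i hi j hj hij h => hij (G.inj i hi j hj h)
  have g1 := D (2 * k + 1) (by omega) (2 * k + 2) (by omega) (by omega)
  have g2 := D (2 * k + 1) (by omega) (2 * k + 3) (by omega) (by omega)
  have g3 := D (2 * k + 1) (by omega) 0 (by omega) (by omega)
  have g4 := D (2 * k + 2) (by omega) (2 * k + 3) (by omega) (by omega)
  have g5 := D (2 * k + 2) (by omega) 0 (by omega) (by omega)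
  have g6 := D (2 * k + 3) (by omega) 0 (by omega) (by omega)
  have r : red k dotted (2 * k + 1) = xor (dotted (2 * k + 1)) (dotted (2 * k + 3)) := by
    simp [red]
  rw [add_assoc]
  congr 1
  simp only [clockwise, leftLabel, lo, hi, mod_a, mod_b, mod_c, mod_d, r, hd] at *
  generalize pos (2 * k + 1) = a at *
  generalize pos (2 * k + 2) = A at *
  generalize pos (2 * k + 3) = B at *
  generalize pos 0 = b at *
  generalize o (2 * k + 1) = p at *
  generalize o (2 * k + 2) = q at *
  generalize o (2 * k + 3) = u at *
  generalize o 0 = v at *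
  generalize dotted (2 * k + 1) = d1 at *
  generalize dotted (2 * k + 3) = d2 at *
  clear D hsm G a1 b1 hab e1 e2 r hd
  subst o3
  subst o2
  subst o1
  rcases Nat.lt_or_gt_of_ne g1 with h1 | h1 <;> rcases Nat.lt_or_gt_of_ne g3 with h3 | h3 <;>
  rcases Nat.lt_or_gt_of_ne g4 with h4 | h4 <;> rcases Nat.lt_or_gt_of_ne g6 with h6 | h6 <;>
  cases d1 <;> cases d2 <;>
  simp only [h1, h3, h4, h6, if_true, if_false, not_lt_of_gt, forall_const, Bool.false_eq_true,
    IsEmpty.forall_iff] at y5 y6 ⊢ <;>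
  first
  | (exfalso; omega)
  | (cases p <;> simp)

end step

lemma main_deg (k : ℕ) : ∀ (pos : ℕ → ℕ) (dotted o : ℕ → Bool), Good (k + 1) pos dotted o →
    deg (2 * (k + 1)) pos dotted o = k + 2 ∨ deg (2 * (k + 1)) pos dotted o = k := by
  induction k with
  | zero =>
    intro pos dotted o G
    have o1 := G.orient 0 (by omega)
    have o2 := G.orient 1 (by omega)
    have d : pos 0 ≠ pos 1 := fun h => by
      have := G.inj 0 (by omega) 1 (by omega) h
      omega
    rw [deg_eq_sum]
    simp only [Nat.zero_add, Nat.mul_one, Finset.sum_range_succ, Finset.sum_range_zero,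
      clockwise, leftLabel, Nat.reduceAdd, Nat.reduceMod, Nat.mod_self] at *
    generalize o 0 = p at *
    generalize o 1 = q at *
    generalize dotted 0 = d0 at *
    generalize dotted 1 = d1 at *
    clear G
    rcases Nat.lt_or_gt_of_ne d with h | h <;>
    simp only [h, if_true, if_false, not_lt_of_gt h] <;> clear h d <;> revert o1 o2 <;>
    revert d0 d1 p q <;> decide
  | succ k ih =>
    intro pos dotted o G
    obtain ⟨t, ht, hd, hsm⟩ := exists_small (by omega) G
    have key : ∃ r < 2 * (k + 2), (2 * k + 2 + r) % (2 * (k + 2)) = t := by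
      by_cases h : 2 * k + 2 ≤ t
      · exact ⟨t - (2 * k + 2), by omega, by
          rw [show 2 * k + 2 + (t - (2 * k + 2)) = t by omega]
          exact Nat.mod_eq_of_lt ht⟩
      · exact ⟨t + 2, by omega, by
          rw [show 2 * k + 2 + (t + 2) = t + 2 * (k + 2) by omega, Nat.add_mod_right]
          exact Nat.mod_eq_of_lt ht⟩
    obtain ⟨r, hr, hrt⟩ := key
    have G' := good_rot hr G
    rw [← deg_rot hr]
    have hd' : rot (2 * (k + 2)) r dotted (2 * k + 2) = false := by
      simp only [rot]
      rw [hrt]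
      exact hd
    have hsm' : ∀ v < 2 * (k + 2),
        ¬ (lo (2 * (k + 2)) (rot (2 * (k + 2)) r pos) (2 * k + 2)
            < rot (2 * (k + 2)) r pos v ∧
          rot (2 * (k + 2)) r pos v
            < hi (2 * (k + 2)) (rot (2 * (k + 2)) r pos) (2 * k + 2)) := by
      intro v _
      rw [lo_rot, hi_rot, hrt]
      exact hsm _ (Nat.mod_lt _ (by omega))
    have e := deg_red G' hd' hsm'
    have := ih _ _ _ (good_red G' hd' hsm')
    rw [show k + 1 + 1 = k + 2 by omega]
    omega

lemma deg_compl {n : ℕ} {pos : ℕ → ℕ} {dotted o : ℕ → Bool} :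
    deg n pos dotted o + deg n pos dotted (fun t => !(o t)) = n := by
  have : ∀ t, clockwise n pos dotted (fun t => !(o t)) t = !(clockwise n pos dotted o t) := by
    intro t
    simp only [clockwise, leftLabel]
    split_ifs <;> rfl
  rw [deg_eq_sum, deg_eq_sum, ← Finset.sum_add_distrib]
  conv_rhs => rw [← Finset.card_range n, Finset.card_eq_sum_ones]
  refine Finset.sum_congr rfl fun t _ => ?_
  rw [this]
  cases clockwise n pos dotted o t <;> simp

lemma orient_compl {n : ℕ} {dotted o : ℕ → Bool} (h : IsOrient n dotted o) :
    IsOrient n dotted (fun t => !(o t)) := by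
  intro t ht
  simp only [h t ht]
  split_ifs <;> rfl

lemma orient_unique {n : ℕ} {dotted o o' : ℕ → Bool} (h : IsOrient n dotted o)
    (h' : IsOrient n dotted o') (h0 : o' 0 = o 0) : ∀ t < n, o' t = o t := by
  intro t
  induction t with
  | zero => exact fun _ => h0
  | succ t ih =>
    intro ht
    have a := h t (by omega)
    have b := h' t (by omega)
    rw [Nat.mod_eq_of_lt ht] at a b
    rw [a, b, ih (by omega)]

end CircleDiagram

open CircleDiagram in
theorem circle_two_orientations_degrees (s : ℕ) (hs : 0 < s)
    (pos : ℕ → ℕ) (dotted : ℕ → Bool)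
    -- the vertices sit at pairwise distinct positions:
    (hinj : ∀ t < 2 * s, ∀ t' < 2 * s, pos t = pos t' → t = t')
    -- planarity: arcs on the same side (same parity) do not cross:
    (hnc : ∀ t < 2 * s, ∀ t' < 2 * s, t % 2 = t' % 2 →
      ¬ (lo (2 * s) pos t < lo (2 * s) pos t' ∧
          lo (2 * s) pos t' < hi (2 * s) pos t ∧
          hi (2 * s) pos t < hi (2 * s) pos t'))
    -- decoration rule: a dotted arc is not nested inside an arc on the same side:
    (hdot : ∀ t < 2 * s, dotted t = true → ∀ t' < 2 * s, t % 2 = t' % 2 →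
      ¬ (lo (2 * s) pos t' < lo (2 * s) pos t ∧
          hi (2 * s) pos t < hi (2 * s) pos t')) :
    -- (1) the circle admits no orientation at all, or exactly two
    --     (an orientation and its reversal):
    ((¬ ∃ o, IsOrient (2 * s) dotted o) ∨
      ∃ o, IsOrient (2 * s) dotted o ∧ IsOrient (2 * s) dotted (fun t => !(o t)) ∧
        ∀ o', IsOrient (2 * s) dotted o' →
          (∀ t < 2 * s, o' t = o t) ∨ (∀ t < 2 * s, o' t = !(o t))) ∧
    -- (2) the degrees of the two orientations are `s + 1` and `s - 1`
    --     (`s` = number of caps of the circle); in particular they differ by 2: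
    (∀ o, IsOrient (2 * s) dotted o →
      (deg (2 * s) pos dotted o = s + 1 ∧
          deg (2 * s) pos dotted (fun t => !(o t)) = s - 1) ∨
      (deg (2 * s) pos dotted o = s - 1 ∧
          deg (2 * s) pos dotted (fun t => !(o t)) = s + 1)) := by
  refine ⟨?_, ?_⟩
  · by_cases h : ∃ o, IsOrient (2 * s) dotted o
    · right
      obtain ⟨o, ho⟩ := h
      refine ⟨o, ho, orient_compl ho, fun o' ho' => ?_⟩
      by_cases h0 : o' 0 = o 0
      · exact Or.inl (orient_unique ho ho' h0)
      · refine Or.inr (orient_unique (orient_compl ho) ho' ?_)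
        revert h0
        cases o' 0 <;> cases o 0 <;> simp
    · exact Or.inl h
  · intro o ho
    obtain ⟨k, rfl⟩ : ∃ k, s = k + 1 := ⟨s - 1, by omega⟩
    have h1 := main_deg k pos dotted o ⟨hinj, hnc, hdot, ho⟩
    have h2 := deg_compl (n := 2 * (k + 1)) (pos := pos) (dotted := dotted) (o := o)
    omega
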